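/- Let φ : [0,∞) → ℝ be bounded, twice differentiable with bounded first and second derivatives. Then x · pv∫₀^∞ (φ(x) − φ(y))/(x−y)² dy → 0 as x → 0⁺, where for each x > 0 the integral is understood as the principal value lim_{ε→0⁺} ∫_{y≥0, |x−y|≥ε} (φ(x) − φ(y))/(x−y)² dy (which exists for such φ). -/

import Mathlib

open Filter Set MeasureTheory Topology

/-- The principal value `pv ∫_{y ≥ 0} (φ(x) - φ(y))/(x-y)² dy` converges to `L`. -/
def KPvTendsto (φ : ℝ → ℝ) (x L : ℝ) : Prop :=
  Tendsto (fun ε : ℝ => ∫ y in {y : ℝ | 0 ≤ y ∧ ε ≤ |x - y|}, (φ x - φ y) / (x - y) ^ 2)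
    (𝓝[>] 0) (𝓝 L)

/-- The value of the principal value `pv ∫_{y ≥ 0} (φ(x) - φ(y))/(x-y)² dy`
(junk value if the limit does not exist). -/
noncomputable def KPv (φ : ℝ → ℝ) (x : ℝ) : ℝ :=
  limUnder (𝓝[>] (0 : ℝ))
    (fun ε : ℝ => ∫ y in {y : ℝ | 0 ≤ y ∧ ε ≤ |x - y|}, (φ x - φ y) / (x - y) ^ 2)

/-- First-order Taylor estimate on a convex set for a function with bounded second derivative. -/
lemma abs_sub_sub_deriv_mul_le {s : Set ℝ} (hs : Convex ℝ s) {f f' f'' : ℝ → ℝ} {M : ℝ}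
    (hf : ∀ x ∈ s, HasDerivWithinAt f (f' x) s x)
    (hf' : ∀ x ∈ s, HasDerivWithinAt f' (f'' x) s x)
    (hM : ∀ x ∈ s, |f'' x| ≤ M) {x y : ℝ} (hx : x ∈ s) (hy : y ∈ s) :
    |f y - f x - f' x * (y - x)| ≤ M * (y - x) ^ 2 := by
  have hM0 : 0 ≤ M := (abs_nonneg _).trans (hM x hx)
  have hsub : uIcc x y ⊆ s := by
    rw [← segment_eq_uIcc]
    exact hs.segment_subset hx hy
  have hd : ∀ z ∈ uIcc x y,
      HasDerivWithinAt (fun z => f z - f' x * z) (f' z - f' x) (uIcc x y) z := fun z hz =>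
    (((hf z (hsub hz)).mono hsub).sub ((hasDerivWithinAt_id z _).const_mul (f' x))).congr_deriv
      (by rw [mul_one])
  have hb : ∀ z ∈ uIcc x y, ‖f' z - f' x‖ ≤ M * |y - x| := fun z hz =>
    (hs.norm_image_sub_le_of_norm_hasDerivWithin_le hf' hM hx (hsub hz)).trans
      (mul_le_mul_of_nonneg_left (abs_sub_left_of_mem_uIcc hz) hM0)
  have key := (convex_uIcc x y).norm_image_sub_le_of_norm_hasDerivWithin_le hd hb
    left_mem_uIcc right_mem_uIcc
  rw [Real.norm_eq_abs, Real.norm_eq_abs, mul_assoc, abs_mul_abs_self] at key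
  convert key using 2 <;> ring

/-- A truncation of `c / (x - y)` symmetric about `x` has zero integral. -/
lemma integral_indicator_div_sub_eq_zero (x c ε : ℝ) :
    ∫ y, (Ioo 0 (2 * x) ∩ {y | ε ≤ |x - y|}).indicator (fun y => c / (x - y)) y = 0 := by
  set k := (Ioo 0 (2 * x) ∩ {y | ε ≤ |x - y|}).indicator (fun y => c / (x - y))
  have hodd : ∀ y, k (2 * x - y) = -k y := fun y => by
    have hmem : 2 * x - y ∈ Ioo 0 (2 * x) ∩ {y | ε ≤ |x - y|} ↔
        y ∈ Ioo 0 (2 * x) ∩ {y | ε ≤ |x - y|} := by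
      simp only [mem_inter_iff, mem_Ioo, mem_ofPred_eq]
      rw [show x - (2 * x - y) = -(x - y) by ring, abs_neg]
      constructor <;> rintro ⟨⟨h1, h2⟩, h3⟩ <;> exact ⟨⟨by linarith, by linarith⟩, h3⟩
    by_cases h : y ∈ Ioo 0 (2 * x) ∩ {y | ε ≤ |x - y|}
    · simp only [k, indicator_of_mem h, indicator_of_mem (hmem.2 h)]
      rw [show x - (2 * x - y) = -(x - y) by ring, div_neg]
    · simp only [k, indicator_of_notMem h, indicator_of_notMem (mt hmem.1 h), neg_zero]
  have h := integral_sub_left_eq_self k volume (2 * x)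
  simp only [hodd, integral_neg] at h
  linarith

lemma integrable_indicator_div_sub (x c : ℝ) {ε : ℝ} (hε : 0 < ε) :
    Integrable ((Ioo 0 (2 * x) ∩ {y | ε ≤ |x - y|}).indicator (fun y => c / (x - y))) := by
  have hms : MeasurableSet (Ioo 0 (2 * x) ∩ {y | ε ≤ |x - y|}) :=
    measurableSet_Ioo.inter (measurableSet_le (by fun_prop) (by fun_prop))
  rw [integrable_indicator_iff hms]
  refine Measure.integrableOn_of_bounded (M := |c| / ε)
    (measure_ne_top_of_subset inter_subset_left measure_Ioo_lt_top.ne)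
    (Measurable.aestronglyMeasurable (by fun_prop)) ?_
  filter_upwards [ae_restrict_mem hms] with y hy
  rw [Real.norm_eq_abs, abs_div]
  exact div_le_div_of_nonneg_left (abs_nonneg c) hε hy.2

/-- The difference quotient with its odd singular part on `(0, 2x)` removed. -/
noncomputable def regularizedKernel (φ : ℝ → ℝ) (c x y : ℝ) : ℝ :=
  (φ x - φ y) / (x - y) ^ 2 - (Ioo 0 (2 * x)).indicator (fun y => c / (x - y)) y

/-- An integrable majorant of the regularized kernel. -/
noncomputable def kernelMajorant (M x : ℝ) : ℝ → ℝ :=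
  (Iio (2 * x)).piecewise (fun _ => M) (fun y => 2 * M * (y + -x) ^ (-(3 / 2) : ℝ))

lemma kernelMajorant_integrableOn_and_integral (M : ℝ) {x : ℝ} (hx : 0 < x) :
    IntegrableOn (kernelMajorant M x) (Ioi 0) ∧
      ∫ y in Ioi 0, kernelMajorant M x y = 2 * x * M + 4 * M * x ^ (-(1 / 2) : ℝ) := by
  have hunion : Ioi (0 : ℝ) = Ioo 0 (2 * x) ∪ Ici (2 * x) :=
    (Ioo_union_Ici_eq_Ioi (by linarith)).symm
  have hIoo : EqOn (kernelMajorant M x) (fun _ => M) (Ioo 0 (2 * x)) := fun y hy =>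
    piecewise_eq_of_mem _ _ _ hy.2
  have hIci : EqOn (kernelMajorant M x) (fun y => 2 * M * (y + -x) ^ (-(3 / 2) : ℝ))
      (Ici (2 * x)) := fun y hy =>
    piecewise_eq_of_notMem _ _ _ (notMem_Iio.2 hy)
  have hi1 : IntegrableOn (kernelMajorant M x) (Ioo 0 (2 * x)) :=
    (integrableOn_congr_fun hIoo measurableSet_Ioo).2
      (integrableOn_const measure_Ioo_lt_top.ne)
  have hi2 : IntegrableOn (kernelMajorant M x) (Ici (2 * x)) := by
    rw [integrableOn_congr_fun hIci measurableSet_Ici, integrableOn_Ici_iff_integrableOn_Ioi]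
    exact (integrableOn_add_rpow_Ioi_of_lt (by norm_num) (by linarith)).const_mul _
  refine ⟨hunion ▸ hi1.union hi2, ?_⟩
  have hdisj : Disjoint (Ioo 0 (2 * x)) (Ici (2 * x)) :=
    disjoint_left.2 fun y hy hy' => not_lt.2 (mem_Ici.1 hy') hy.2
  rw [hunion, setIntegral_union hdisj measurableSet_Ici hi1 hi2,
    setIntegral_congr_fun measurableSet_Ioo hIoo, setIntegral_congr_fun measurableSet_Ici hIci,
    integral_Ici_eq_integral_Ioi, integral_const_mul, setIntegral_const]
  have hshift : ∫ y in Ioi (2 * x), (y + -x) ^ (-(3 / 2) : ℝ) = 2 * x ^ (-(1 / 2) : ℝ) := by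
    have h := (measurePreserving_add_right volume (-x)).setIntegral_preimage_emb
      (measurableEmbedding_addRight (-x)) (fun y : ℝ => y ^ (-(3 / 2) : ℝ)) (Ioi x)
    have hpre : (fun y => y + -x) ⁻¹' Ioi x = Ioi (2 * x) := by
      ext y
      simp only [mem_preimage, mem_Ioi]
      constructor <;> intro h <;> linarith
    rw [hpre, integral_Ioi_rpow_of_lt (by norm_num) hx] at h
    rw [h]
    norm_num
    ring
  rw [hshift]
  simp [hx.le]
  ring

section Kernel

variable {φ φ' φ'' : ℝ → ℝ} {M : ℝ}

lemma abs_regularizedKernel_le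
    (hφ_bdd : ∀ x, 0 ≤ x → |φ x| ≤ M)
    (hφ' : ∀ x, 0 ≤ x → HasDerivWithinAt φ (φ' x) (Ici 0) x)
    (hφ'' : ∀ x, 0 ≤ x → HasDerivWithinAt φ' (φ'' x) (Ici 0) x)
    (hφ'_bdd : ∀ x, 0 ≤ x → |φ' x| ≤ M)
    (hφ''_bdd : ∀ x, 0 ≤ x → |φ'' x| ≤ M) {x y : ℝ} (hx : 0 < x) (hy : 0 < y) :
    |regularizedKernel φ (φ' x) x y| ≤ kernelMajorant M x y := by
  have hM : 0 ≤ M := (abs_nonneg _).trans (hφ_bdd 0 le_rfl)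
  unfold regularizedKernel kernelMajorant
  rcases lt_or_ge y (2 * x) with h | h
  · rw [indicator_of_mem (show y ∈ Ioo 0 (2 * x) from ⟨hy, h⟩), piecewise_eq_of_mem _ _ _ (mem_Iio.2 h)]
    rcases eq_or_ne y x with rfl | hne
    · simpa using hM
    have hne' : x - y ≠ 0 := sub_ne_zero.2 hne.symm
    have ht := abs_sub_sub_deriv_mul_le (convex_Ici 0) hφ' hφ'' hφ''_bdd hx.le hy.le
    have heq : (φ x - φ y) / (x - y) ^ 2 - φ' x / (x - y) =
        -(φ y - φ x - φ' x * (y - x)) / (x - y) ^ 2 := by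
      field_simp
      ring
    rw [heq, abs_div, abs_neg, abs_of_nonneg (sq_nonneg (x - y)),
      div_le_iff₀ (by positivity)]
    rwa [sub_sq_comm x y]
  · rw [indicator_of_notMem (fun hy' => not_lt.2 h hy'.2),
      piecewise_eq_of_notMem _ _ _ (notMem_Iio.2 h), sub_zero, abs_div,
      abs_of_nonneg (sq_nonneg (x - y))]
    set u := y + -x with hu
    have hu0 : 0 < u := by linarith
    have hsq : (x - y) ^ 2 = u ^ 2 := by rw [hu]; ring
    rw [hsq, div_le_iff₀ (by positivity)]
    have hpow : ∀ a : ℝ, u ^ a * u ^ 2 = u ^ (a + 2) := fun a => by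
      rw [Real.rpow_add hu0, Real.rpow_ofNat]
    rw [mul_assoc, hpow]
    rcases le_total u 1 with hu1 | hu1
    · have hl := (convex_Ici (0 : ℝ)).norm_image_sub_le_of_norm_hasDerivWithin_le hφ' hφ'_bdd
        hx.le hy.le
      rw [Real.norm_eq_abs, Real.norm_eq_abs, abs_of_pos (show 0 < y - x by linarith),
        show y - x = u from sub_eq_add_neg y x, abs_sub_comm] at hl
      have h1 : u ^ (1 : ℝ) ≤ u ^ (-(3 / 2) + 2 : ℝ) :=
        Real.rpow_le_rpow_of_exponent_ge hu0 hu1 (by norm_num)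
      rw [Real.rpow_one] at h1
      nlinarith
    · have h1 : 1 ≤ u ^ (-(3 / 2) + 2 : ℝ) := Real.one_le_rpow hu1 (by norm_num)
      have h2 := (abs_sub (φ x) (φ y)).trans (add_le_add (hφ_bdd x hx.le) (hφ_bdd y hy.le))
      nlinarith

lemma aestronglyMeasurable_regularizedKernel (hφ : ContinuousOn φ (Ioi 0)) (c x : ℝ) :
    AEStronglyMeasurable (regularizedKernel φ c x) (volume.restrict (Ioi 0)) := by
  have h1 : AEMeasurable φ (volume.restrict (Ioi 0)) := hφ.aemeasurable measurableSet_Ioi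
  have h2 : Measurable ((Ioo 0 (2 * x)).indicator (fun y => c / (x - y))) :=
    Measurable.indicator (by fun_prop) measurableSet_Ioo
  have h3 : AEMeasurable (fun y => (φ x - φ y) / (x - y) ^ 2) (volume.restrict (Ioi 0)) :=
    (aemeasurable_const.sub h1).div (by fun_prop)
  exact (h3.sub h2.aemeasurable).aestronglyMeasurable

lemma integral_truncated_eq {x c ε : ℝ} (hε : 0 < ε)
    (hg : IntegrableOn (regularizedKernel φ c x) (Ioi 0)) :
    ∫ y in {y : ℝ | 0 ≤ y ∧ ε ≤ |x - y|}, (φ x - φ y) / (x - y) ^ 2 =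
      ∫ y in Ioi 0, {y | ε ≤ |x - y|}.indicator (regularizedKernel φ c x) y := by
  have hms : MeasurableSet {y : ℝ | ε ≤ |x - y|} :=
    measurableSet_le (by fun_prop) (by fun_prop)
  have hset : ({y : ℝ | 0 ≤ y ∧ ε ≤ |x - y|} : Set ℝ) =ᵐ[volume]
      (Ioi 0 ∩ {y | ε ≤ |x - y|} : Set ℝ) :=
    Ioi_ae_eq_Ici.symm.inter (ae_eq_refl _)
  rw [setIntegral_congr_set hset, ← setIntegral_indicator hms]
  have hk := integrable_indicator_div_sub x c hε
  have hzero : ∫ y in Ioi 0,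
      (Ioo 0 (2 * x) ∩ {y | ε ≤ |x - y|}).indicator (fun y => c / (x - y)) y = 0 := by
    rw [setIntegral_eq_integral_of_forall_compl_eq_zero, integral_indicator_div_sub_eq_zero]
    exact fun y hy => indicator_of_notMem (fun h => hy h.1.1) _
  have hadd := integral_add (hg.indicator hms) (hk.integrableOn (s := Ioi 0))
  rw [hzero, add_zero] at hadd
  rw [← hadd]
  congr 1 with y
  rw [inter_comm, ← indicator_indicator]
  by_cases h : y ∈ {y | ε ≤ |x - y|} <;> simp [h, regularizedKernel]

lemma integrableOn_regularizedKernel (hφ : ContinuousOn φ (Ioi 0)) {c x : ℝ} (hx : 0 < x)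
    (hb : ∀ y, 0 < y → |regularizedKernel φ c x y| ≤ kernelMajorant M x y) :
    IntegrableOn (regularizedKernel φ c x) (Ioi 0) :=
  (kernelMajorant_integrableOn_and_integral M hx).1.mono'
    (aestronglyMeasurable_regularizedKernel hφ c x)
    ((ae_restrict_mem measurableSet_Ioi).mono hb)

lemma kPvTendsto_integral_regularizedKernel {x c : ℝ}
    (hg : IntegrableOn (regularizedKernel φ c x) (Ioi 0)) :
    KPvTendsto φ x (∫ y in Ioi 0, regularizedKernel φ c x y) := by
  have hlim : Tendsto
      (fun ε : ℝ => ∫ y in Ioi 0, {y | ε ≤ |x - y|}.indicator (regularizedKernel φ c x) y)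
      (𝓝[>] 0) (𝓝 (∫ y in Ioi 0, regularizedKernel φ c x y)) := by
    refine tendsto_integral_filter_of_dominated_convergence
      (fun y => ‖regularizedKernel φ c x y‖)
      (Eventually.of_forall fun ε => hg.aestronglyMeasurable.indicator
        (measurableSet_le (by fun_prop) (by fun_prop)))
      (Eventually.of_forall fun ε => Eventually.of_forall fun y => norm_indicator_le_norm_self _ _)
      hg.norm ?_
    filter_upwards [ae_restrict_of_ae (Measure.ae_ne volume x)] with y hy
    refine tendsto_const_nhds.congr' ?_
    have hpos : 0 < |x - y| := abs_pos.2 (sub_ne_zero.2 hy.symm)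
    filter_upwards [Ioo_mem_nhdsGT hpos] with ε hε
    exact (indicator_of_mem (show y ∈ {y | ε ≤ |x - y|} from hε.2.le) _).symm
  refine hlim.congr' ?_
  filter_upwards [self_mem_nhdsWithin] with ε hε
  exact (integral_truncated_eq hε hg).symm

end Kernel

/-- For `φ` bounded and twice differentiable on `[0,∞)` with bounded first
and second derivatives, the principal value `pv ∫₀^∞ (φ(x) - φ(y))/(x-y)² dy` exists for
every `x > 0` and `x · pv ∫₀^∞ (φ(x) - φ(y))/(x-y)² dy → 0` as `x → 0⁺`. -/
theorem wishart_operator_vanishes_at_zero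
    (φ φ' φ'' : ℝ → ℝ) (M : ℝ)
    (hφ_bdd : ∀ x, 0 ≤ x → |φ x| ≤ M)
    (hφ' : ∀ x, 0 ≤ x → HasDerivWithinAt φ (φ' x) (Set.Ici 0) x)
    (hφ'' : ∀ x, 0 ≤ x → HasDerivWithinAt φ' (φ'' x) (Set.Ici 0) x)
    (hφ'_bdd : ∀ x, 0 ≤ x → |φ' x| ≤ M)
    (hφ''_bdd : ∀ x, 0 ≤ x → |φ'' x| ≤ M) :
    (∀ x : ℝ, 0 < x → KPvTendsto φ x (KPv φ x)) ∧
    Tendsto (fun x : ℝ => x * KPv φ x) (𝓝[>] 0) (𝓝 0) := by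
  have hφc : ContinuousOn φ (Ioi 0) := fun x hx =>
    ((hφ' x (le_of_lt hx)).continuousWithinAt).mono Ioi_subset_Ici_self
  have hb : ∀ x, 0 < x → ∀ y, 0 < y →
      |regularizedKernel φ (φ' x) x y| ≤ kernelMajorant M x y := fun x hx y hy =>
    abs_regularizedKernel_le hφ_bdd hφ' hφ'' hφ'_bdd hφ''_bdd hx hy
  have hpv : ∀ x, 0 < x → KPvTendsto φ x (∫ y in Ioi 0, regularizedKernel φ (φ' x) x y) :=
    fun x hx => kPvTendsto_integral_regularizedKernel
      (integrableOn_regularizedKernel hφc hx (hb x hx))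
  have heq : ∀ x, 0 < x → KPv φ x = ∫ y in Ioi 0, regularizedKernel φ (φ' x) x y :=
    fun x hx => (hpv x hx).limUnder_eq
  refine ⟨fun x hx => heq x hx ▸ hpv x hx, ?_⟩
  have hbound : ∀ᶠ x : ℝ in 𝓝[>] 0,
      ‖x * KPv φ x‖ ≤ 2 * M * x ^ 2 + 4 * M * x ^ (1 / 2 : ℝ) := by
    filter_upwards [self_mem_nhdsWithin] with x (hx : 0 < x)
    obtain ⟨hi, hint⟩ := kernelMajorant_integrableOn_and_integral M hx
    have h : ‖∫ y in Ioi 0, regularizedKernel φ (φ' x) x y‖ ≤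
        2 * x * M + 4 * M * x ^ (-(1 / 2) : ℝ) :=
      hint ▸ norm_integral_le_of_norm_le hi ((ae_restrict_mem measurableSet_Ioi).mono (hb x hx))
    have hpow : x * x ^ (-(1 / 2) : ℝ) = x ^ (1 / 2 : ℝ) := by
      nth_rewrite 1 [← Real.rpow_one x]
      rw [← Real.rpow_add hx]
      norm_num
    rw [heq x hx, norm_mul, Real.norm_of_nonneg hx.le, ← hpow]
    exact (mul_le_mul_of_nonneg_left h hx.le).trans_eq (by ring)
  refine squeeze_zero_norm' hbound (tendsto_nhdsWithin_of_tendsto_nhds ?_)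
  have hcont : Continuous fun x : ℝ => 2 * M * x ^ 2 + 4 * M * x ^ (1 / 2 : ℝ) :=
    (by fun_prop : Continuous fun x : ℝ => 2 * M * x ^ 2).add
      ((Real.continuous_rpow_const (by norm_num)).const_mul (4 * M))
  simpa using hcont.tendsto 0
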